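/- Let n ∈ ℝ^N be a unit vector, η ∈ (0,1), and let F : ℝ^N → [0,∞) be measurable with ∫ F(v)(1+|v|²) dv < ∞, such that h(G−1) is integrable against (v·n)₊ M(v) dv, where G := F/M, and Λ_n(G) > 0. Set 𝒟𝒢 := (1/√(2π)) ( Λ_n(h(G−1)) − h(Λ_n(G)−1) ) and J := ∫_{ℝ^N} min( (v·n)₊², 1 ) M(v) dv > 0. Then the outgoing mass flux is controlled by the Darrozes-Guiraud information and the second normal moment: ∫_{ℝ^N} F(v)(v·n)₊ dv ≤ (1/J) [ (1/h(η)) 𝒟𝒢 + (1/(√(2π)(1−η))) ∫_{ℝ^N} F(v)(v·n)² dv ]. -/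

import Mathlib

open MeasureTheory Real Set
open scoped RealInnerProductSpace

/-- The standard Gaussian density `M(v) = (2π)^{−N/2} exp(−|v|²/2)` on `ℝ^N`. -/
noncomputable def gaussM {N : ℕ} (v : EuclideanSpace ℝ (Fin N)) : ℝ :=
  (2 * π) ^ (-(N : ℝ) / 2) * Real.exp (-‖v‖ ^ 2 / 2)

/-- The relative-entropy integrand `h(z) = (1+z)·log(1+z) − z`
(with the convention `h(−1) = 1`, which holds here since `Real.log 0 = 0`). -/
noncomputable def entH (z : ℝ) : ℝ := (1 + z) * Real.log (1 + z) - z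

/-- The boundary average `Λ_n(φ) = √(2π) ∫ φ(v)(v·n)₊ M(v) dv`. -/
noncomputable def Lam {N : ℕ} (n : EuclideanSpace ℝ (Fin N))
    (φ : EuclideanSpace ℝ (Fin N) → ℝ) : ℝ :=
  Real.sqrt (2 * π) * ∫ v, φ v * max ⟪v, n⟫ 0 * gaussM v

lemma aux_gaussM_pos {N : ℕ} (v : EuclideanSpace ℝ (Fin N)) : 0 < gaussM v := by
  unfold gaussM; positivity

lemma aux_gaussM_cont {N : ℕ} : Continuous (gaussM (N := N)) := by
  unfold gaussM; fun_prop

lemma aux_charfun {N : ℕ} (n : EuclideanSpace ℝ (Fin N)) (hn : ‖n‖ = 1) (t : ℝ) :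
    ∫ v : EuclideanSpace ℝ (Fin N), ((gaussM v : ℝ) : ℂ) * Complex.exp (t * ⟪v, n⟫ * Complex.I)
      = Complex.exp (-t ^ 2 / 2) := by
  have h := GaussianFourier.integral_cexp_neg_mul_sq_norm_add_of_euclideanSpace
    (b := 1 / 2) (by norm_num) (t * Complex.I) n
  have e : ∀ v : EuclideanSpace ℝ (Fin N),
      ((gaussM v : ℝ) : ℂ) * Complex.exp (t * ⟪v, n⟫ * Complex.I)
      = (((2 * π) ^ (-(N : ℝ) / 2) : ℝ) : ℂ) *
        Complex.exp (-(1 / 2) * ‖v‖ ^ 2 + t * Complex.I * ⟪n, v⟫) := by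
    intro v
    unfold gaussM
    push_cast
    rw [mul_assoc, ← Complex.exp_add, real_inner_comm]
    congr 2
    ring
  simp_rw [e]
  rw [integral_const_mul, h, hn]
  have e2 : ((π : ℂ) / (1 / 2)) ^ ((Fintype.card (Fin N) : ℂ) / 2)
      = (((2 * π) ^ ((N : ℝ) / 2) : ℝ) : ℂ) := by
    rw [Complex.ofReal_cpow (by positivity)]
    push_cast
    simp
    ring_nf
  rw [e2, ← mul_assoc, ← Complex.ofReal_mul, ← Real.rpow_add (by positivity)]
  have : -(N : ℝ) / 2 + N / 2 = 0 := by ring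
  rw [this]
  simp
  congr 1
  rw [mul_pow, Complex.I_sq]
  ring

lemma aux_gaussM_integrable {N : ℕ} : Integrable (gaussM (N := N)) := by
  have h := GaussianFourier.integrable_cexp_neg_mul_sq_norm_add
    (V := EuclideanSpace ℝ (Fin N)) (b := 1 / 2) (by norm_num) 0 0
  have h2 := h.norm.const_mul ((2 * π) ^ (-(N : ℝ) / 2))
  refine h2.congr (Filter.Eventually.of_forall fun v => ?_)
  simp only [gaussM, Complex.norm_exp]
  congr 2
  have : (-(1 / 2 : ℂ) * (‖v‖ : ℂ) ^ 2 + 0 * ((⟪(0 : EuclideanSpace ℝ (Fin N)), v⟫ : ℝ) : ℂ))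
      = ((-‖v‖ ^ 2 / 2 : ℝ) : ℂ) := by push_cast; ring
  rw [this, Complex.ofReal_re]

lemma aux_map {N : ℕ} (n : EuclideanSpace ℝ (Fin N)) (hn : ‖n‖ = 1) :
    (volume.withDensity (fun v : EuclideanSpace ℝ (Fin N) => ENNReal.ofReal (gaussM v))).map
      (fun v => ⟪v, n⟫) = ProbabilityTheory.gaussianReal 0 1 := by
  have hm : Measurable (fun v : EuclideanSpace ℝ (Fin N) => (⟪v, n⟫ : ℝ)) := by fun_prop
  have hf : IsFiniteMeasure
      (volume.withDensity (fun v : EuclideanSpace ℝ (Fin N) => ENNReal.ofReal (gaussM v))) :=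
    isFiniteMeasure_withDensity_ofReal aux_gaussM_integrable.2
  apply Measure.ext_of_charFun
  ext t
  rw [charFun_apply_real, ProbabilityTheory.charFun_gaussianReal,
    integral_map hm.aemeasurable (by fun_prop),
    integral_withDensity_eq_integral_toReal_smul
      (aux_gaussM_cont.measurable.ennreal_ofReal) (by simp)]
  have := aux_charfun n hn t
  simp only [ENNReal.toReal_ofReal (aux_gaussM_pos _).le, Complex.real_smul]
  rw [this]
  congr 1
  push_cast
  ring

lemma aux_flux {N : ℕ} (n : EuclideanSpace ℝ (Fin N)) (hn : ‖n‖ = 1) :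
    ∫ v : EuclideanSpace ℝ (Fin N), max ⟪v, n⟫ 0 * gaussM v = 1 / √(2 * π) := by
  have hm : Measurable (fun v : EuclideanSpace ℝ (Fin N) => (⟪v, n⟫ : ℝ)) := by fun_prop
  have h1 : ∫ x : ℝ, max x 0 ∂(ProbabilityTheory.gaussianReal 0 1)
      = ∫ v : EuclideanSpace ℝ (Fin N), max ⟪v, n⟫ 0 * gaussM v := by
    rw [← aux_map n hn, integral_map hm.aemeasurable (by fun_prop),
      integral_withDensity_eq_integral_toReal_smul
        (aux_gaussM_cont.measurable.ennreal_ofReal) (by simp)]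
    simp only [ENNReal.toReal_ofReal (aux_gaussM_pos _).le, smul_eq_mul, mul_comm]
  rw [← h1, ProbabilityTheory.integral_gaussianReal_eq_integral_smul (by simp)]
  have h2 : ∀ x : ℝ, ProbabilityTheory.gaussianPDFReal 0 1 x • max x 0
      = (Ioi (0 : ℝ)).indicator
        (fun x => (√(2 * π))⁻¹ * (x ^ (1 : ℝ) * rexp (-(1 / 2) * x ^ (2 : ℝ)))) x := by
    intro x
    by_cases hx : 0 < x
    · rw [indicator_of_mem (by exact hx), max_eq_left hx.le, ProbabilityTheory.gaussianPDFReal]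
      simp
      try ring_nf
    · rw [indicator_of_notMem (by exact hx), max_eq_right (not_lt.1 hx)]
      simp
  simp_rw [h2]
  rw [integral_indicator measurableSet_Ioi, integral_const_mul,
    integral_rpow_mul_exp_neg_mul_rpow (by norm_num) (by norm_num) (by norm_num)]
  norm_num

lemma aux_entH (z : ℝ) : entH z = InformationTheory.klFun (1 + z) := by
  unfold entH InformationTheory.klFun; ring

lemma aux_h1 {η : ℝ} (hη : η ∈ Ioo (0 : ℝ) 1) :
    InformationTheory.klFun (1 + η) ≤ InformationTheory.klFun (1 - η) := by
  have hd : ∀ x ∈ Ico (0 : ℝ) 1, HasDerivAt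
      (fun x => InformationTheory.klFun (1 - x) - InformationTheory.klFun (1 + x))
      (log (1 - x) * (-1) - log (1 + x) * 1) x := by
    intro x hx
    have a := (InformationTheory.hasDerivAt_klFun (x := 1 - x) (by linarith [hx.2])).comp x
      ((hasDerivAt_id x).const_sub 1)
    have b := (InformationTheory.hasDerivAt_klFun (x := 1 + x) (by linarith [hx.1])).comp x
      ((hasDerivAt_id x).const_add 1)
    exact a.sub b
  have hmono : MonotoneOn
      (fun x => InformationTheory.klFun (1 - x) - InformationTheory.klFun (1 + x)) (Ico 0 1) := by
    apply monotoneOn_of_deriv_nonneg (convex_Ico 0 1)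
    · exact fun x hx => (hd x hx).continuousAt.continuousWithinAt
    · intro x hx
      exact (hd x (interior_subset hx)).differentiableAt.differentiableWithinAt
    · intro x hx
      have hx' := interior_subset hx
      rw [(hd x hx').deriv]
      have : log (1 - x) + log (1 + x) ≤ 0 := by
        rw [← log_mul (by linarith [hx'.2]) (by linarith [hx'.1])]
        apply log_nonpos
        · nlinarith [hx'.1, hx'.2]
        · nlinarith [hx'.1, hx'.2]
      linarith
  have := hmono (a := 0) (b := η) (by simp) ⟨hη.1.le, hη.2⟩ hη.1.le
  simp at this
  linarith

lemma aux_h2 {η g : ℝ} (hη : η ∈ Ioo (0 : ℝ) 1) (hg : 0 ≤ g) (hg' : g ≤ 1 - η) :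
    InformationTheory.klFun (1 - η) ≤ InformationTheory.klFun g := by
  have hy : 0 < 1 - η := by linarith [hη.2]
  have hk := mul_nonneg hy.le (InformationTheory.klFun_nonneg (div_nonneg hg hy.le))
  have hl : log (1 - η) ≤ 0 := log_nonpos hy.le (by linarith [hη.1])
  have hp : 0 ≤ (g - (1 - η)) * log (1 - η) :=
    mul_nonneg_of_nonpos_of_nonpos (by linarith) hl
  have e : (1 - η) * InformationTheory.klFun (g / (1 - η))
      = g * log g - g * log (1 - η) + (1 - η) - g := by
    rw [InformationTheory.klFun_apply]
    rcases hg.eq_or_lt with rfl | hg0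
    · simp
    · rw [log_div hg0.ne' hy.ne']
      field_simp
  rw [e] at hk
  rw [InformationTheory.klFun_apply, InformationTheory.klFun_apply]
  nlinarith

lemma aux_pt {η G L x M s : ℝ} (hη : η ∈ Ioo (0 : ℝ) 1) (hG : 0 ≤ G) (hL : 0 < L)
    (hM : 0 < M) (hs : 1 ≤ s) :
    (1 / s) * (L * (min ((max x 0) ^ 2) 1 * M)) ≤
      (1 / entH η) * (L * InformationTheory.klFun (G / L) * (max x 0) * M)
        + (1 / (s * (1 - η))) * (G * M * x ^ 2) := by
  have hy : 0 < 1 - η := by linarith [hη.2]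
  have hx : 0 ≤ max x 0 := le_max_right _ _
  have hx2 : (max x 0) ^ 2 ≤ x ^ 2 := by
    rcases le_total x 0 with h | h
    · rw [max_eq_right h]; nlinarith
    · rw [max_eq_left h]
  have hmx : min ((max x 0) ^ 2) 1 ≤ max x 0 := by
    rcases le_total (max x 0) 1 with h | h
    · exact (min_le_left _ _).trans (by nlinarith)
    · exact (min_le_right _ _).trans h
  have hm0 : 0 ≤ min ((max x 0) ^ 2) 1 := by positivity
  have hk := InformationTheory.klFun_nonneg (div_nonneg hG hL.le)
  have hE : 0 < entH η := by
    rw [aux_entH]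
    refine lt_of_le_of_ne (InformationTheory.klFun_nonneg (by linarith [hη.1])) fun h => ?_
    have := (InformationTheory.klFun_eq_zero_iff (by linarith [hη.1])).1 h.symm
    linarith [hη.1]
  have hs0 : 0 < s := by linarith
  rcases le_total (G / L) (1 - η) with h | h
  · have h1 : entH η ≤ InformationTheory.klFun (G / L) := by
      rw [aux_entH]
      exact (aux_h1 hη).trans (aux_h2 hη (div_nonneg hG hL.le) h)
    have h3 : 0 ≤ (1 / (s * (1 - η))) * (G * M * x ^ 2) := by positivity
    have h2 : (1 / s) * (L * (min ((max x 0) ^ 2) 1 * M)) ≤ 1 * (L * (max x 0 * M)) := by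
      gcongr
      rw [div_le_one hs0]; exact hs
    have h4 : 1 ≤ (1 / entH η) * InformationTheory.klFun (G / L) := by
      rw [one_div, inv_mul_eq_div, le_div_iff₀ hE]; linarith
    have h5 : 0 ≤ L * (max x 0 * M) := by positivity
    have h6 := mul_le_mul_of_nonneg_right h4 h5
    calc _ ≤ _ := h2
      _ ≤ _ := h6
      _ = (1 / entH η) * (L * InformationTheory.klFun (G / L) * (max x 0) * M) := by ring
      _ ≤ _ := by linarith
  · have h3 : 0 ≤ (1 / entH η) * (L * InformationTheory.klFun (G / L) * (max x 0) * M) := by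
      positivity
    have h4 : L ≤ G / (1 - η) := by
      rw [le_div_iff₀ hL] at h
      rw [le_div_iff₀ hy]; linarith
    have h5 : (1 / s) * (L * (min ((max x 0) ^ 2) 1 * M))
        ≤ (1 / s) * (G / (1 - η) * (x ^ 2 * M)) := by
      gcongr
      exact (min_le_left _ _).trans hx2
    have h6 : (1 / s) * (G / (1 - η) * (x ^ 2 * M))
        = (1 / (s * (1 - η))) * (G * M * x ^ 2) := by field_simp
    linarith

/-- Control of the outgoing mass flux by the Darrozes-Guiraud information and
the second normal moment (pointwise form of the outgoing mass flux lemma):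
with `G = F/M`, `𝒟𝒢 = (1/√(2π))(Λ_n(h(G−1)) − h(Λ_n(G)−1))` and
`J = ∫ min((v·n)₊², 1) M dv > 0`,
`∫ F (v·n)₊ dv ≤ (1/J)( (1/h(η)) 𝒟𝒢 + (1/(√(2π)(1−η))) ∫ F (v·n)² dv )`. -/
theorem outgoing_mass_flux_control {N : ℕ}
    (n : EuclideanSpace ℝ (Fin N)) (hn : ‖n‖ = 1)
    (η : ℝ) (hη : η ∈ Set.Ioo (0 : ℝ) 1)
    (F : EuclideanSpace ℝ (Fin N) → ℝ) (hFmeas : Measurable F)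
    (hFnonneg : ∀ v, 0 ≤ F v)
    (hFint : Integrable fun v => F v * (1 + ‖v‖ ^ 2))
    (hhGint : Integrable fun v => entH (F v / gaussM v - 1) * max ⟪v, n⟫ 0 * gaussM v)
    (hGpos : 0 < Lam n fun v => F v / gaussM v) :
    (0 < ∫ v, min ((max ⟪v, n⟫ 0) ^ 2) 1 * gaussM v) ∧
    (∫ v, F v * max ⟪v, n⟫ 0)
      ≤ (1 / ∫ v, min ((max ⟪v, n⟫ 0) ^ 2) 1 * gaussM v) *
          ((1 / entH η) *
              ((1 / Real.sqrt (2 * π)) *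
                (Lam n (fun v => entH (F v / gaussM v - 1))
                  - entH ((Lam n fun v => F v / gaussM v) - 1)))
            + (1 / (Real.sqrt (2 * π) * (1 - η))) * ∫ v, F v * ⟪v, n⟫ ^ 2) := by
  have hMc := aux_gaussM_cont (N := N)
  have hJint : Integrable fun v : EuclideanSpace ℝ (Fin N) =>
      min ((max ⟪v, n⟫ 0) ^ 2) 1 * gaussM v := by
    refine aux_gaussM_integrable.mono' (Continuous.aestronglyMeasurable (by fun_prop))
      (Filter.Eventually.of_forall fun v => ?_)
    have := aux_gaussM_pos v
    have h0 : 0 ≤ min ((max (⟪v, n⟫ : ℝ) 0) ^ 2) 1 := by positivity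
    rw [Real.norm_of_nonneg (by positivity)]
    have := min_le_right ((max (⟪v, n⟫ : ℝ) 0) ^ 2) 1
    nlinarith
  have hJ : 0 < ∫ v : EuclideanSpace ℝ (Fin N), min ((max ⟪v, n⟫ 0) ^ 2) 1 * gaussM v := by
    apply integral_pos_of_integrable_nonneg_nonzero (x := n) (by fun_prop) hJint
    · intro v
      have := aux_gaussM_pos v
      show 0 ≤ min ((max (⟪v, n⟫ : ℝ) 0) ^ 2) 1 * gaussM v
      positivity
    · have := aux_gaussM_pos n
      simp [hn, this.ne']
  refine ⟨hJ, ?_⟩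
  have hs0 : 0 < √(2 * π) := by positivity
  have hs1 : 1 ≤ √(2 * π) := by
    rw [Real.one_le_sqrt]; linarith [Real.pi_gt_three]
  have hin : ∀ v : EuclideanSpace ℝ (Fin N), |(⟪v, n⟫ : ℝ)| ≤ ‖v‖ := fun v => by
    simpa [hn] using abs_real_inner_le_norm v n
  have hFx : Integrable fun v => F v * max (⟪v, n⟫ : ℝ) 0 := by
    refine hFint.mono' (by fun_prop) (Filter.Eventually.of_forall fun v => ?_)
    have h1 : max (⟪v, n⟫ : ℝ) 0 ≤ 1 + ‖v‖ ^ 2 :=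
      max_le (by nlinarith [le_abs_self (⟪v, n⟫ : ℝ), hin v, sq_nonneg (‖v‖ - 1)]) (by positivity)
    have h0 : 0 ≤ max (⟪v, n⟫ : ℝ) 0 := le_max_right _ _
    rw [Real.norm_of_nonneg (mul_nonneg (hFnonneg v) h0)]
    exact mul_le_mul_of_nonneg_left h1 (hFnonneg v)
  have hFx2 : Integrable fun v => F v * (⟪v, n⟫ : ℝ) ^ 2 := by
    refine hFint.mono' (by fun_prop) (Filter.Eventually.of_forall fun v => ?_)
    have h1 : (⟪v, n⟫ : ℝ) ^ 2 ≤ 1 + ‖v‖ ^ 2 := by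
      have := sq_le_sq' (by linarith [neg_abs_le (⟪v, n⟫ : ℝ), hin v])
        ((le_abs_self (⟪v, n⟫ : ℝ)).trans (hin v))
      linarith
    rw [Real.norm_of_nonneg (mul_nonneg (hFnonneg v) (sq_nonneg _))]
    exact mul_le_mul_of_nonneg_left h1 (hFnonneg v)
  have hflux := aux_flux n hn
  have hxM : Integrable fun v : EuclideanSpace ℝ (Fin N) => max (⟪v, n⟫ : ℝ) 0 * gaussM v := by
    by_contra h
    rw [integral_undef h] at hflux
    have : 0 < 1 / √(2 * π) := by positivity
    linarith
  set L := Lam n fun v => F v / gaussM v with hL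
  have hLF : L = √(2 * π) * ∫ v, F v * max ⟪v, n⟫ 0 := by
    rw [hL, Lam]
    congr 2
    ext v
    have := aux_gaussM_pos v
    field_simp
  -- the Darrozes-Guiraud density
  have hP : ∀ v : EuclideanSpace ℝ (Fin N),
      L * InformationTheory.klFun (F v / gaussM v / L) * max ⟪v, n⟫ 0 * gaussM v
      = entH (F v / gaussM v - 1) * max ⟪v, n⟫ 0 * gaussM v
        - log L * (F v * max ⟪v, n⟫ 0) + (L - 1) * (max ⟪v, n⟫ 0 * gaussM v) := by
    intro v
    have hM := aux_gaussM_pos v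
    obtain ⟨G, hG⟩ : ∃ G, G = F v / gaussM v := ⟨_, rfl⟩
    have hF : F v = G * gaussM v := by rw [hG]; field_simp
    have hG0 : 0 ≤ G := by rw [hG]; exact div_nonneg (hFnonneg v) hM.le
    rw [← hG, hF]
    have e : L * InformationTheory.klFun (G / L) = entH (G - 1) - log L * G + (L - 1) := by
      rw [aux_entH, InformationTheory.klFun_apply, InformationTheory.klFun_apply]
      rcases hG0.eq_or_lt with h | h
      · rw [← h]; simp
      · rw [log_div h.ne' hGpos.ne', show 1 + (G - 1) = G by ring]
        field_simp
        ring
    rw [e]; ring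
  have hPint : Integrable fun v : EuclideanSpace ℝ (Fin N) =>
      L * InformationTheory.klFun (F v / gaussM v / L) * max ⟪v, n⟫ 0 * gaussM v := by
    simp_rw [hP]
    exact (hhGint.sub (hFx.const_mul _)).add (hxM.const_mul _)
  have hDG : (1 / √(2 * π)) * (Lam n (fun v => entH (F v / gaussM v - 1)) - entH (L - 1))
      = ∫ v, L * InformationTheory.klFun (F v / gaussM v / L) * max ⟪v, n⟫ 0 * gaussM v := by
    simp_rw [hP]
    have hsub : Integrable fun v : EuclideanSpace ℝ (Fin N) =>
        entH (F v / gaussM v - 1) * max ⟪v, n⟫ 0 * gaussM v - log L * (F v * max ⟪v, n⟫ 0) :=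
      hhGint.sub (hFx.const_mul _)
    rw [integral_add hsub (hxM.const_mul _),
      integral_sub hhGint (hFx.const_mul _), integral_const_mul, integral_const_mul, hflux]
    have : ∫ v, F v * max ⟪v, n⟫ 0 = L / √(2 * π) := by rw [hLF]; field_simp
    rw [this, Lam, entH, show 1 + (L - 1) = L by ring]
    field_simp
    ring
  rw [hDG, one_div_mul_eq_div _, le_div_iff₀ hJ]
  have key := integral_mono (μ := volume)
    (f := fun v : EuclideanSpace ℝ (Fin N) =>
      (1 / √(2 * π)) * (L * (min ((max ⟪v, n⟫ 0) ^ 2) 1 * gaussM v)))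
    (g := fun v => (1 / entH η) *
      (L * InformationTheory.klFun (F v / gaussM v / L) * max ⟪v, n⟫ 0 * gaussM v)
        + (1 / (√(2 * π) * (1 - η))) * (F v * ⟪v, n⟫ ^ 2))
    ((hJint.const_mul _).const_mul _)
    ((hPint.const_mul _).add (hFx2.const_mul _))
    (fun v => by
      have hM := aux_gaussM_pos v
      have := aux_pt (x := ⟪v, n⟫) hη (div_nonneg (hFnonneg v) hM.le) hGpos hM hs1
      rwa [div_mul_cancel₀ _ hM.ne'] at this)
  rw [integral_add (hPint.const_mul _) (hFx2.const_mul _), integral_const_mul,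
    integral_const_mul, integral_const_mul, integral_const_mul] at key
  refine le_trans (le_of_eq ?_) key
  rw [hLF]
  field_simp
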